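/- For every crossing-free matching M of P and every point p of P that is isolated in M, the weighted sum Σ_{i=0}^{5} (5−i)·h_i(p,M) is at most 48. -/

import Mathlib

open scoped Classical

noncomputable section

/-- A point of the plane. -/
abbrev Pt : Type := ℝ × ℝ

/-- The closed straight-line segment with endpoints `a` and `b`. -/
def Seg (a b : Pt) : Set Pt := segment ℝ a b

/-- `P` is in general position: no three points of `P` are collinear and
no two points of `P` have the same `x`-coordinate. -/
def GenPos (P : Finset Pt) : Prop :=
  (∀ p ∈ P, ∀ q ∈ P, ∀ r ∈ P, p ≠ q → q ≠ r → p ≠ r →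
      ¬ Collinear ℝ ({p, q, r} : Set Pt)) ∧
  ∀ p ∈ P, ∀ q ∈ P, p ≠ q → p.1 ≠ q.1

/-- `M` is a crossing-free matching of `P`.  Each edge is recorded as an ordered
pair `(left endpoint, right endpoint)`, the left endpoint being the one of
smaller `x`-coordinate.  No point is an endpoint of more than one edge and no
two distinct edges intersect. -/
structure IsMatching (P : Finset Pt) (M : Finset (Pt × Pt)) : Prop where
  left_mem : ∀ e ∈ M, e.1 ∈ P
  right_mem : ∀ e ∈ M, e.2 ∈ P
  x_lt : ∀ e ∈ M, e.1.1 < e.2.1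
  no_shared : ∀ e ∈ M, ∀ f ∈ M, e ≠ f →
      e.1 ≠ f.1 ∧ e.1 ≠ f.2 ∧ e.2 ≠ f.1 ∧ e.2 ≠ f.2
  no_cross : ∀ e ∈ M, ∀ f ∈ M, e ≠ f → Seg e.1 e.2 ∩ Seg f.1 f.2 = ∅

/-- `p` is isolated in `M`: it is an endpoint of no edge of `M`. -/
def Isolated (M : Finset (Pt × Pt)) (p : Pt) : Prop :=
  ∀ e ∈ M, e.1 ≠ p ∧ e.2 ≠ p

/-- The `y`-coordinate of the point of the line through the endpoints of `e`
having abscissa `x`. -/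
def yOn (e : Pt × Pt) (x : ℝ) : ℝ :=
  e.1.2 + (x - e.1.1) * (e.2.2 - e.1.2) / (e.2.1 - e.1.1)

/-- The point of (the line supporting) the edge `e` with the same
`x`-coordinate as `q`. -/
def vproj (e : Pt × Pt) (q : Pt) : Pt := (q.1, yOn e q.1)

/-- `q` is vertically visible from the interior of the edge `e` of `M`:
its `x`-coordinate lies strictly between the `x`-coordinates of the endpoints
of `e`, and the open vertical segment joining `q` to the point of `e` with the
same `x`-coordinate meets no edge of `M` and contains no point of `P`. -/
def VertVisible (P : Finset Pt) (M : Finset (Pt × Pt)) (q : Pt) (e : Pt × Pt) : Prop :=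
  e.1.1 < q.1 ∧ q.1 < e.2.1 ∧
  (∀ f ∈ M, openSegment ℝ q (vproj e q) ∩ Seg f.1 f.2 = ∅) ∧
  ∀ r ∈ P, r ∉ openSegment ℝ q (vproj e q)

/-- `p` is the left endpoint of some edge of `M`. -/
def IsLeftEndpoint (M : Finset (Pt × Pt)) (p : Pt) : Prop := ∃ e ∈ M, e.1 = p

/-- `p` is the right endpoint of some edge of `M`. -/
def IsRightEndpoint (M : Finset (Pt × Pt)) (p : Pt) : Prop := ∃ e ∈ M, e.2 = p

/-- The rank `d_M(p)` of `p` in `M`. -/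
def rank (P : Finset Pt) (M : Finset (Pt × Pt)) (p : Pt) : ℕ :=
  if h : ∃ e ∈ M, e.1 = p then
    (P.filter fun q =>
      (Isolated M q ∨ IsLeftEndpoint M q) ∧ VertVisible P M q h.choose).card
  else if h' : ∃ e ∈ M, e.2 = p then
    (P.filter fun q =>
      (Isolated M q ∨ IsRightEndpoint M q) ∧ VertVisible P M q h'.choose).card
  else 0

/-- The result of inserting the edge `qp` into `M` (oriented left-to-right). -/
def addEdge (M : Finset (Pt × Pt)) (q p : Pt) : Finset (Pt × Pt) :=
  if q.1 < p.1 then insert (q, p) M else insert (p, q) M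

/-- `h_i(p,M)`: the number of points `q ∈ P` such that `M ∪ {qp}` is a
crossing-free matching of `P` in which `p` has rank `i`. -/
def hcount (P : Finset Pt) (M : Finset (Pt × Pt)) (p : Pt) (i : ℕ) : ℕ :=
  (P.filter fun q =>
    IsMatching P (addEdge M q p) ∧ rank P (addEdge M q p) p = i).card

/-- `l_i(p,M)`: the number of points `q ∈ P` to the left of `p` such that
`M ∪ {qp}` is a crossing-free matching of `P` in which `p` has rank `i`. -/
def lcount (P : Finset Pt) (M : Finset (Pt × Pt)) (p : Pt) (i : ℕ) : ℕ :=
  (P.filter fun q => q.1 < p.1 ∧ IsMatching P (insert (q, p) M) ∧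
    rank P (insert (q, p) M) p = i).card

/-- `v_i(M)`: the number of points of `P` of rank `i` in `M`. -/
def vcount (P : Finset Pt) (M : Finset (Pt × Pt)) (i : ℕ) : ℕ :=
  (P.filter fun p => rank P M p = i).card

/-- The (finite) collection of crossing-free matchings of `P` with `m` edges. -/
def Matchings (P : Finset Pt) (m : ℕ) : Finset (Finset (Pt × Pt)) :=
  (P ×ˢ P).powerset.filter fun M => IsMatching P M ∧ M.card = m

/-- `Ma_m(P)`: the number of crossing-free matchings of `P` with `m` edges. -/
def Ma (P : Finset Pt) (m : ℕ) : ℕ := (Matchings P m).card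

/-- `S_k(m)`: the sum of `Σ_{i=0}^{k} (k-i) h_i(p,M')` over all pairs `(p, M')`
with `M'` a crossing-free matching of `P` with `m-1` edges and `p ∈ P`
isolated in `M'`. -/
def Ssum (P : Finset Pt) (k m : ℕ) : ℕ :=
  ∑ M ∈ Matchings P (m - 1), ∑ p ∈ P.filter (fun p => Isolated M p),
    ∑ i ∈ Finset.range (k + 1), (k - i) * hcount P M p i

/-- The union of the edges of `M`, as a subset of the plane. -/
def edgesSet (M : Finset (Pt × Pt)) : Set Pt := ⋃ e ∈ M, Seg e.1 e.2

/-- The vertical wall of `r`: the maximal open vertical segment through `r`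
meeting no edge of `M` except possibly at `r` itself. -/
def Wall (M : Finset (Pt × Pt)) (r : Pt) : Set Pt :=
  {x : Pt | x.1 = r.1 ∧
    ∀ z : Pt, z.1 = r.1 → z.2 ∈ Set.uIcc x.2 r.2 → z ≠ r → z ∉ edgesSet M}

/-- The complement of the union of all edges of `M` and all vertical walls of
points of `P`; its connected components are the cells of the vertical
decomposition. -/
def FreeRegion (P : Finset Pt) (M : Finset (Pt × Pt)) : Set Pt :=
  (edgesSet M ∪ ⋃ r ∈ P, Wall M r)ᶜ

/-- `T` is a cell of the vertical decomposition of `M`. -/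
def IsCell (P : Finset Pt) (M : Finset (Pt × Pt)) (T : Set Pt) : Prop :=
  ∃ x ∈ FreeRegion P M, T = connectedComponentIn (FreeRegion P M) x

/-- `T` is the cell containing the points `(x(p) - ε, y(p))` for all
sufficiently small `ε > 0`. -/
def IsLeftCellOf (P : Finset Pt) (M : Finset (Pt × Pt)) (p : Pt) (T : Set Pt) : Prop :=
  IsCell P M T ∧ ∃ ε₀ > (0 : ℝ), ∀ ε : ℝ, 0 < ε → ε < ε₀ →
    ((p.1 - ε, p.2) : Pt) ∈ T

/-- `T` is the cell containing the points `(x(p) + ε, y(p))` for all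
sufficiently small `ε > 0`. -/
def IsRightCellOf (P : Finset Pt) (M : Finset (Pt × Pt)) (p : Pt) (T : Set Pt) : Prop :=
  IsCell P M T ∧ ∃ ε₀ > (0 : ℝ), ∀ ε : ℝ, 0 < ε → ε < ε₀ →
    ((p.1 + ε, p.2) : Pt) ∈ T

/-- `q` is the left bifurcation point of `p`: part of the boundary of the cell
to the left of `p` lies on the vertical wall of `q`, and `x(q)` is the infimum
of the abscissas of points of that cell. -/
def IsLeftBifPoint (P : Finset Pt) (M : Finset (Pt × Pt)) (p q : Pt) : Prop :=
  q ∈ P ∧ ∃ T, IsLeftCellOf P M p T ∧ (frontier T ∩ Wall M q).Nonempty ∧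
    IsGLB {x : ℝ | ∃ y : ℝ, ((x, y) : Pt) ∈ T} q.1

/-- `q` is the right bifurcation point of `p`. -/
def IsRightBifPoint (P : Finset Pt) (M : Finset (Pt × Pt)) (p q : Pt) : Prop :=
  q ∈ P ∧ ∃ T, IsRightCellOf P M p T ∧ (frontier T ∩ Wall M q).Nonempty ∧
    IsLUB {x : ℝ | ∃ y : ℝ, ((x, y) : Pt) ∈ T} q.1

/-- The edge `e` of `M` is vertically visible below `p`. -/
def EdgeVisBelow (P : Finset Pt) (M : Finset (Pt × Pt)) (e : Pt × Pt) (p : Pt) : Prop :=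
  e.1.1 < p.1 ∧ p.1 < e.2.1 ∧ yOn e p.1 < p.2 ∧
  (∀ f ∈ M, openSegment ℝ p (vproj e p) ∩ Seg f.1 f.2 = ∅) ∧
  ∀ r ∈ P, r ∉ openSegment ℝ p (vproj e p)

/-- The edge `e` of `M` is vertically visible above `p`. -/
def EdgeVisAbove (P : Finset Pt) (M : Finset (Pt × Pt)) (e : Pt × Pt) (p : Pt) : Prop :=
  e.1.1 < p.1 ∧ p.1 < e.2.1 ∧ p.2 < yOn e p.1 ∧
  (∀ f ∈ M, openSegment ℝ p (vproj e p) ∩ Seg f.1 f.2 = ∅) ∧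
  ∀ r ∈ P, r ∉ openSegment ℝ p (vproj e p)

end

def fB : ℕ → ℕ
  | 0 => 0
  | k+1 => max (k + 1 + fB k) (2 * fB k)

theorem core_aux (P : Finset Pt) (X y : Pt → ℝ) (hX : ∀ a ∈ P, ∀ b ∈ P, X a = X b → a = b)
    (M : Finset (Pt × Pt)) (lo hi : Pt × Pt → Pt) (F : Pt × Pt → ℝ → ℝ)
    (hlo : ∀ f ∈ M, lo f ∈ P) (hhi : ∀ f ∈ M, hi f ∈ P)
    (hinj : ∀ f ∈ M, ∀ g ∈ M, hi f = hi g → f = g)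
    (hF : ∀ f ∈ M, F f (X (hi f)) = y (hi f))
    (Q : Finset Pt) (hQP : Q ⊆ P) (hQi : ∀ q ∈ Q, ∀ f ∈ M, lo f ≠ q ∧ hi f ≠ q)
    (p : Pt) (Y : Pt → ℝ → ℝ)
    (hYq : ∀ q ∈ Q, Y q (X q) = y q)
    (hside : ∀ q ∈ Q, ∀ f ∈ M, ∀ s s', X q ≤ s → s ≤ X p → X q ≤ s' → s' ≤ X p →
      X (lo f) ≤ s → s ≤ X (hi f) → X (lo f) ≤ s' → s' ≤ X (hi f) →
      (Y q s < F f s ↔ Y q s' < F f s'))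
    (V : Pt → Pt → Prop)
    (hV : ∀ q r, V q r ↔ (X q < X r ∧ X r < X p ∧
      ((∀ f ∈ M, lo f ≠ r ∧ hi f ≠ r) ∨ ∃ f ∈ M, hi f = r) ∧
      ∀ g ∈ M, X (lo g) ≤ X r → X r < X (hi g) →
        (y r < F g (X r) ↔ Y q (X r) < F g (X r)))) :
    ∀ n : ℕ, ∀ t : ℝ, t ≤ X p → (P.filter fun r => X r < t).card = n →
      ∀ S : Finset Pt, S ⊆ Q → (∀ q ∈ S, X q < t) →
      (∀ q ∈ S, ∀ q' ∈ S, ∀ f ∈ M, X (lo f) < t → t ≤ X (hi f) →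
        (Y q t < F f t ↔ Y q' t < F f t)) →
      ∀ k : ℕ, ∑ q ∈ S, (k - (P.filter fun r => V q r ∧ X r < t).card) ≤ fB k := by
  intro n
  induction n with
  | zero =>
    intro t ht hn S hS hSt hL k
    rw [Finset.card_eq_zero] at hn
    have : S = ∅ := by
      apply Finset.eq_empty_of_forall_notMem
      intro q hq
      have : q ∈ P.filter fun r => X r < t := by
        simp [hQP (hS hq), hSt q hq]
      rw [hn] at this
      simp at this
    subst this
    simp
  | succ n ih =>
    intro t ht hn S hS hSt hL k
    have hne : (P.filter fun r => X r < t).Nonempty := by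
      rw [← Finset.card_pos]; omega
    obtain ⟨r, hr, hmax⟩ := Finset.exists_max_image _ X hne
    rw [Finset.mem_filter] at hr
    obtain ⟨hrP, hrt⟩ := hr
    have hmax' : ∀ x ∈ P, X x < t → x = r ∨ X x < X r := by
      intro x hx hxt
      have := hmax x (by simp [hx, hxt])
      rcases this.lt_or_eq with h | h
      · exact Or.inr h
      · exact Or.inl (hX x hx r hrP h)
    have hcard : (P.filter fun x => X x < X r).card = n := by
      have : (P.filter fun x => X x < t) = insert r (P.filter fun x => X x < X r) := by
        ext x
        simp only [Finset.mem_filter, Finset.mem_insert]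
        constructor
        · rintro ⟨h1, h2⟩
          rcases hmax' x h1 h2 with h | h
          · exact Or.inl h
          · exact Or.inr ⟨h1, h⟩
        · rintro (h | ⟨h1, h2⟩)
          · subst h; exact ⟨hrP, hrt⟩
          · exact ⟨h1, h2.trans hrt⟩
      rw [this, Finset.card_insert_of_notMem (by simp)] at hn
      omega
    have hrp : X r < X p := lt_of_lt_of_le hrt ht
    -- R-connectivity at `X r`
    have hR : ∀ q ∈ S, ∀ q' ∈ S, ∀ f ∈ M, X (lo f) ≤ X r → X r < X (hi f) →
        (Y q (X r) < F f (X r) ↔ Y q' (X r) < F f (X r)) := by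
      have key : ∀ q ∈ S, ∀ f ∈ M, X (lo f) ≤ X r → X r < X (hi f) →
          t ≤ X (hi f) ∧ (Y q (X r) < F f (X r) ↔ Y q t < F f t) := by
        intro q hq f hf h1 h2
        have h3 : t ≤ X (hi f) := by
          by_contra h
          rcases hmax' _ (hhi f hf) (not_le.mp h) with h4 | h4
          · rw [h4] at h2; exact lt_irrefl _ h2
          · exact lt_asymm h2 h4
        have h5 : X q ≤ X r := hmax q (by simp [hQP (hS hq), hSt q hq])
        exact ⟨h3, hside q (hS hq) f hf _ _ h5 hrp.le (h5.trans hrt.le) ht h1 h2.le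
          (h1.trans hrt.le) h3⟩
      intro q hq q' hq' f hf h1 h2
      rw [(key q hq f hf h1 h2).2, (key q' hq' f hf h1 h2).2]
      exact hL q hq q' hq' f hf (lt_of_le_of_lt h1 hrt) (key q hq f hf h1 h2).1
    have hlt : ∀ q ∈ S, q ≠ r → X q < X r := fun q hq h =>
      (hmax' q (hQP (hS hq)) (hSt q hq)).resolve_left h
    have cV : ∀ q, V q r → (P.filter fun x => V q x ∧ X x < t).card =
        (P.filter fun x => V q x ∧ X x < X r).card + 1 := by
      intro q hq
      have : (P.filter fun x => V q x ∧ X x < t) =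
          insert r (P.filter fun x => V q x ∧ X x < X r) := by
        ext x
        simp only [Finset.mem_filter, Finset.mem_insert]
        constructor
        · rintro ⟨h1, h2, h3⟩
          rcases hmax' x h1 h3 with h | h
          · exact Or.inl h
          · exact Or.inr ⟨h1, h2, h⟩
        · rintro (h | ⟨h1, h2, h3⟩)
          · subst h; exact ⟨hrP, hq, hrt⟩
          · exact ⟨h1, h2, h3.trans hrt⟩
      rw [this, Finset.card_insert_of_notMem (by simp)]
    have cN : ∀ q, ¬ V q r → (P.filter fun x => V q x ∧ X x < t).card =
        (P.filter fun x => V q x ∧ X x < X r).card := by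
      intro q hq
      congr 1
      ext x
      simp only [Finset.mem_filter]
      constructor
      · rintro ⟨h1, h2, h3⟩
        rcases hmax' x h1 h3 with h | h
        · subst h; exact absurd h2 hq
        · exact ⟨h1, h2, h⟩
      · rintro ⟨h1, h2, h3⟩
        exact ⟨h1, h2, h3.trans hrt⟩
    -- L edges at `X r` are R edges unless they end in `r`
    have hLR : ∀ f ∈ M, X r ≤ X (hi f) → hi f ≠ r → X r < X (hi f) := by
      intro f hf h1 h2
      rcases h1.lt_or_eq with h | h
      · exact h
      · exact absurd (hX _ hrP _ (hhi f hf) h).symm h2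
    have IH := ih (X r) hrp.le hcard
    have fmono : ∀ k, fB k ≤ fB (k+1) := by
      intro k
      simp only [fB]
      exact le_max_of_le_left (by omega)
    -- sum bound for all-visible sets
    have hvis : ∀ T ⊆ S, (∀ q ∈ T, V q r) → ∀ k,
        ∑ q ∈ T, (k + 1 - (P.filter fun x => V q x ∧ X x < t).card) =
        ∑ q ∈ T, (k - (P.filter fun x => V q x ∧ X x < X r).card) := by
      intro T _ hTV k
      apply Finset.sum_congr rfl
      intro q hq
      rw [cV q (hTV q hq)]
      omega
    rcases k with _ | k
    · simp
    by_cases hrS : r ∈ S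
    · -- `r` itself is a candidate
      have hri := hQi r (hS hrS)
      have hTV : ∀ q ∈ S.erase r, V q r := by
        intro q hq
        rw [Finset.mem_erase] at hq
        rw [hV]
        refine ⟨hlt q hq.2 hq.1, hrp, Or.inl hri, ?_⟩
        intro g hg h1 h2
        have := hR r hrS q hq.2 g hg h1 h2
        rwa [hYq r (hS hrS)] at this
      rw [← Finset.add_sum_erase _ _ hrS, hvis _ (Finset.erase_subset _ _) hTV]
      have := IH (S.erase r) ((Finset.erase_subset _ _).trans hS)
        (fun q hq => hlt q (Finset.mem_of_mem_erase hq) (Finset.ne_of_mem_erase hq))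
        (fun q hq q' hq' f hf h1 h2 => hR q (Finset.mem_of_mem_erase hq) q'
          (Finset.mem_of_mem_erase hq') f hf h1.le (hLR f hf h2 (hri f hf).2)) k
      have h3 : k + 1 + fB k ≤ fB (k+1) := by simp only [fB]; exact le_max_left _ _
      omega
    · have hSr : ∀ q ∈ S, X q < X r := fun q hq => hlt q hq (fun h => hrS (h ▸ hq))
      have hVV : ∀ q ∈ S, ∀ q' ∈ S, V q r → V q' r := by
        intro q hq q' hq' h
        rw [hV] at h ⊢
        refine ⟨hSr q' hq', hrp, h.2.2.1, ?_⟩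
        intro g hg h1 h2
        rw [h.2.2.2 g hg h1 h2]
        exact hR q hq q' hq' g hg h1 h2
      by_cases hre : ∃ f ∈ M, hi f = r
      · obtain ⟨f, hf, hfr⟩ := hre
        have hFr : F f (X r) = y r := by rw [← hfr]; exact hF f hf
        by_cases hv : ∃ q ∈ S, V q r
        · obtain ⟨q0, hq0, hv⟩ := hv
          have hTV : ∀ q ∈ S, V q r := fun q hq => hVV q0 hq0 q hq hv
          rw [hvis S subset_rfl hTV, ← Finset.sum_filter_add_sum_filter_not S
            (fun q => Y q (X r) < F f (X r))]
          have A := IH (S.filter fun q => Y q (X r) < F f (X r))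
            ((Finset.filter_subset _ _).trans hS)
            (fun q hq => hSr q (Finset.mem_filter.mp hq).1)
            (by
              intro q hq q' hq' g hg h1 h2
              rw [Finset.mem_filter] at hq hq'
              by_cases hgr : hi g = r
              · have : g = f := hinj g hg f hf (hgr.trans hfr.symm)
                subst this
                exact iff_of_true hq.2 hq'.2
              · exact hR q hq.1 q' hq'.1 g hg h1.le (hLR g hg h2 hgr)) k
          have B := IH (S.filter fun q => ¬ Y q (X r) < F f (X r))
            ((Finset.filter_subset _ _).trans hS)
            (fun q hq => hSr q (Finset.mem_filter.mp hq).1)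
            (by
              intro q hq q' hq' g hg h1 h2
              rw [Finset.mem_filter] at hq hq'
              by_cases hgr : hi g = r
              · have : g = f := hinj g hg f hf (hgr.trans hfr.symm)
                subst this
                exact iff_of_false hq.2 hq'.2
              · exact hR q hq.1 q' hq'.1 g hg h1.le (hLR g hg h2 hgr)) k
          have h3 : 2 * fB k ≤ fB (k+1) := by simp only [fB]; exact le_max_right _ _
          omega
        · push Not at hv
          have hsum : ∑ q ∈ S, (k + 1 - (P.filter fun x => V q x ∧ X x < t).card) =
              ∑ q ∈ S, (k + 1 - (P.filter fun x => V q x ∧ X x < X r).card) :=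
            Finset.sum_congr rfl fun q hq => by rw [cN q (hv q hq)]
          rw [hsum]
          apply IH S hS hSr
          intro q hq q' hq' g hg h1 h2
          by_cases hgr : hi g = r
          · have : g = f := hinj g hg f hf (hgr.trans hfr.symm)
            subst this
            have hnv := hv q hq
            rw [hV] at hnv
            have : ∃ e ∈ M, X (lo e) ≤ X r ∧ X r < X (hi e) ∧
                ¬ (y r < F e (X r) ↔ Y q (X r) < F e (X r)) := by
              by_contra hcon
              push Not at hcon
              apply hnv
              exact ⟨hSr q hq, hrp, Or.inr ⟨g, hg, hgr⟩, fun e he h1 h2 => hcon e he h1 h2⟩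
            obtain ⟨e, he, h3, h4, h5⟩ := this
            have h6 := hR q hq q' hq' e he h3 h4
            rw [hFr]
            by_cases h7 : y r < F e (X r)
            · have h8 : ¬ Y q (X r) < F e (X r) := fun h => h5 (iff_of_true h7 h)
              have h9 : ¬ Y q' (X r) < F e (X r) := fun h => h8 (h6.mpr h)
              constructor <;> intro <;> linarith
            · have h8 : Y q (X r) < F e (X r) := by
                by_contra h; exact h5 (iff_of_false h7 h)
              have h9 := h6.mp h8
              constructor <;> intro <;> linarith
          · exact hR q hq q' hq' g hg h1.le (hLR g hg h2 hgr)
      · push Not at hre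
        have IHS := IH S hS hSr (fun q hq q' hq' f hf h1 h2 =>
          hR q hq q' hq' f hf h1.le (hLR f hf h2 (hre f hf)))
        by_cases hv : ∃ q ∈ S, V q r
        · obtain ⟨q0, hq0, hv⟩ := hv
          rw [hvis S subset_rfl (fun q hq => hVV q0 hq0 q hq hv)]
          exact (IHS k).trans (fmono k)
        · push Not at hv
          have hsum : ∑ q ∈ S, (k + 1 - (P.filter fun x => V q x ∧ X x < t).card) =
              ∑ q ∈ S, (k + 1 - (P.filter fun x => V q x ∧ X x < X r).card) :=
            Finset.sum_congr rfl fun q hq => by rw [cN q (hv q hq)]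
          rw [hsum]
          exact IHS (k+1)

theorem core (P : Finset Pt) (X y : Pt → ℝ) (hX : ∀ a ∈ P, ∀ b ∈ P, X a = X b → a = b)
    (M : Finset (Pt × Pt)) (lo hi : Pt × Pt → Pt) (F : Pt × Pt → ℝ → ℝ)
    (hlo : ∀ f ∈ M, lo f ∈ P) (hhi : ∀ f ∈ M, hi f ∈ P)
    (hinj : ∀ f ∈ M, ∀ g ∈ M, hi f = hi g → f = g)
    (hF : ∀ f ∈ M, F f (X (hi f)) = y (hi f))
    (Q : Finset Pt) (hQP : Q ⊆ P) (hQi : ∀ q ∈ Q, ∀ f ∈ M, lo f ≠ q ∧ hi f ≠ q)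
    (p : Pt) (Y : Pt → ℝ → ℝ)
    (hYq : ∀ q ∈ Q, Y q (X q) = y q) (hYp : ∀ q ∈ Q, Y q (X p) = y p)
    (hQp : ∀ q ∈ Q, X q < X p)
    (hside : ∀ q ∈ Q, ∀ f ∈ M, ∀ s s', X q ≤ s → s ≤ X p → X q ≤ s' → s' ≤ X p →
      X (lo f) ≤ s → s ≤ X (hi f) → X (lo f) ≤ s' → s' ≤ X (hi f) →
      (Y q s < F f s ↔ Y q s' < F f s'))
    (rk : Pt → ℕ)
    (hrk : ∀ q ∈ Q, (P.filter fun r => X q < X r ∧ X r < X p ∧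
      ((∀ f ∈ M, lo f ≠ r ∧ hi f ≠ r) ∨ ∃ f ∈ M, hi f = r) ∧
      ∀ g ∈ M, X (lo g) ≤ X r → X r < X (hi g) →
        (y r < F g (X r) ↔ Y q (X r) < F g (X r))).card ≤ rk q) :
    ∑ q ∈ Q, (5 - rk q) ≤ 24 := by
  have h := core_aux P X y hX M lo hi F hlo hhi hinj hF Q hQP hQi p Y hYq hside _
    (fun _ _ => Iff.rfl) _ (X p) le_rfl rfl Q subset_rfl hQp
    (by intro q hq q' hq' f _ _ _; rw [hYp q hq, hYp q' hq']) 5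
  have h24 : fB 5 = 24 := by decide
  rw [h24] at h
  refine le_trans (Finset.sum_le_sum fun q hq => ?_) h
  apply Nat.sub_le_sub_left
  refine le_trans (Finset.card_le_card ?_) (hrk q hq)
  intro x hx
  simp only [Finset.mem_filter] at hx ⊢
  exact ⟨hx.1, hx.2.1⟩

theorem yOn_left (e : Pt × Pt) : yOn e e.1.1 = e.1.2 := by simp [yOn]

theorem yOn_right (e : Pt × Pt) (h : e.1.1 < e.2.1) : yOn e e.2.1 = e.2.2 := by
  have : e.2.1 - e.1.1 ≠ 0 := by linarith
  simp only [yOn]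
  field_simp
  ring

theorem mem_seg_iff (e : Pt × Pt) (h : e.1.1 < e.2.1) (z : Pt) :
    z ∈ Seg e.1 e.2 ↔ e.1.1 ≤ z.1 ∧ z.1 ≤ e.2.1 ∧ z.2 = yOn e z.1 := by
  have hne : e.2.1 - e.1.1 ≠ 0 := by linarith
  have hpos : 0 < e.2.1 - e.1.1 := by linarith
  rw [Seg, segment_eq_image']
  constructor
  · rintro ⟨θ, ⟨h0, h1⟩, rfl⟩
    simp only [Prod.fst_add, Prod.snd_add, Prod.smul_fst, Prod.smul_snd, Prod.fst_sub,
      Prod.snd_sub, smul_eq_mul, yOn]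
    refine ⟨by nlinarith, by nlinarith, ?_⟩
    field_simp
    ring
  · rintro ⟨h0, h1, h2⟩
    refine ⟨(z.1 - e.1.1) / (e.2.1 - e.1.1), ⟨by apply div_nonneg <;> linarith, ?_⟩, ?_⟩
    · rw [div_le_one hpos]; linarith
    · ext
      · simp only [Prod.fst_add, Prod.smul_fst, Prod.fst_sub, smul_eq_mul]
        field_simp
        ring
      · simp only [Prod.snd_add, Prod.smul_snd, Prod.snd_sub, smul_eq_mul]
        rw [h2, yOn]
        field_simp

theorem yOn_cont (e : Pt × Pt) : Continuous (yOn e) := by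
  unfold yOn
  fun_prop

theorem side_const (e f : Pt × Pt) (he : e.1.1 < e.2.1) (hf : f.1.1 < f.2.1)
    (hd : Seg e.1 e.2 ∩ Seg f.1 f.2 = ∅) (s s' : ℝ)
    (h1 : e.1.1 ≤ s) (h2 : s ≤ e.2.1) (h3 : e.1.1 ≤ s') (h4 : s' ≤ e.2.1)
    (h5 : f.1.1 ≤ s) (h6 : s ≤ f.2.1) (h7 : f.1.1 ≤ s') (h8 : s' ≤ f.2.1) 
    (h : yOn e s < yOn f s) : yOn e s' < yOn f s' := by
  by_contra hc
  push Not at hc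
  have hcont : ContinuousOn (fun x => yOn e x - yOn f x) (Set.uIcc s s') :=
    ((yOn_cont e).sub (yOn_cont f)).continuousOn
  have := intermediate_value_uIcc hcont
  have hz : (0:ℝ) ∈ Set.uIcc (yOn e s - yOn f s) (yOn e s' - yOn f s') := by
    rw [Set.mem_uIcc]; left; constructor <;> linarith
  obtain ⟨x, hx, hx0⟩ := this hz
  simp only at hx0
  have hb : min s s' ≤ x ∧ x ≤ max s s' := hx
  have m1 : (x, yOn e x) ∈ Seg e.1 e.2 := by
    rw [mem_seg_iff e he]
    exact ⟨(le_min h1 h3).trans hb.1, hb.2.trans (max_le h2 h4), rfl⟩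
  have m2 : (x, yOn e x) ∈ Seg f.1 f.2 := by
    rw [mem_seg_iff f hf]
    exact ⟨(le_min h5 h7).trans hb.1, hb.2.trans (max_le h6 h8), by simp only; linarith⟩
  have : (x, yOn e x) ∈ Seg e.1 e.2 ∩ Seg f.1 f.2 := ⟨m1, m2⟩
  rw [hd] at this
  exact this

theorem openSeg_vert (r : Pt) (c : ℝ) (hne : r.2 ≠ c) (z : Pt)
    (hz : z ∈ openSegment ℝ r (r.1, c)) :
    z.1 = r.1 ∧ ((r.2 < z.2 ∧ z.2 < c) ∨ (c < z.2 ∧ z.2 < r.2)) := by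
  obtain ⟨a, b, ha, hb, hab, rfl⟩ := hz
  have hb' : b = 1 - a := by linarith
  subst hb'
  simp only [Prod.fst_add, Prod.snd_add, Prod.smul_fst, Prod.smul_snd, smul_eq_mul]
  refine ⟨by ring, ?_⟩
  rcases lt_or_gt_of_ne hne with h | h
  · left; constructor <;> nlinarith
  · right; constructor <;> nlinarith

/-- Visibility from the combinatorial criterion. -/
theorem vis_of (P : Finset Pt) (hP : GenPos P) (M : Finset (Pt × Pt)) (hM : IsMatching P M)
    (e : Pt × Pt) (h1P : e.1 ∈ P) (h2P : e.2 ∈ P) (he : e.1.1 < e.2.1) (r : Pt) (hr : r ∈ P)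
    (h1 : e.1.1 < r.1) (h2 : r.1 < e.2.1)
    (h : ∀ g ∈ M, g.1.1 ≤ r.1 → r.1 ≤ g.2.1 → g.1 ≠ r → g.2 ≠ r →
      (r.2 < yOn g r.1 ↔ yOn e r.1 < yOn g r.1)) :
    VertVisible P (insert e M) r e := by
  have hne : r.2 ≠ yOn e r.1 := by
    intro hc
    have hs : r ∈ Seg e.1 e.2 := (mem_seg_iff e he r).mpr ⟨h1.le, h2.le, hc⟩
    have hcol : Collinear ℝ ({e.1, r, e.2} : Set Pt) := by
      have : Wbtw ℝ e.1 r e.2 := by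
        rw [← mem_segment_iff_wbtw]; exact hs
      exact this.collinear
    refine hP.1 e.1 h1P r hr e.2 h2P ?_ ?_ ?_ hcol
    · intro h; rw [h] at h1; exact lt_irrefl _ h1
    · intro h; rw [← h] at h2; exact lt_irrefl _ h2
    · intro h; rw [h] at he; exact lt_irrefl _ he
  refine ⟨h1, h2, ?_, ?_⟩
  · intro f hf
    rw [Set.eq_empty_iff_forall_notMem]
    rintro z ⟨hz, hzf⟩
    obtain ⟨hz1, hz2⟩ := openSeg_vert r _ hne z hz
    rw [Finset.mem_insert] at hf
    rcases hf with rfl | hf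
    · rw [mem_seg_iff f he] at hzf
      rw [hz1] at hzf
      rcases hz2 with h | h <;> linarith
    · have hx := hM.x_lt f hf
      rw [mem_seg_iff f hx, hz1] at hzf
      obtain ⟨ha, hb, hc⟩ := hzf
      by_cases hl : f.1 = r
      · have := yOn_left f
        rw [hl] at this
        rcases hz2 with h | h <;> linarith
      by_cases hl' : f.2 = r
      · have := yOn_right f hx
        rw [hl'] at this
        rcases hz2 with h | h <;> linarith
      have := h f hf ha hb hl hl'
      rw [← hc] at this
      rcases hz2 with h | h
      · have := this.mp h.1; linarith
      · have := this.mpr h.1; linarith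
  · intro x hx hxs
    obtain ⟨hz1, hz2⟩ := openSeg_vert r _ hne x hxs
    have : x = r := by
      by_contra hcon
      exact hP.2 x hx r hr hcon hz1
    subst this
    rcases hz2 with h | h <;> linarith [h.1, h.2]

theorem rank_left (P : Finset Pt) (M : Finset (Pt × Pt)) (p q : Pt) (hqp : q.1 < p.1)
    (hiso : Isolated M p) :
    rank P (insert (q, p) M) p = (P.filter fun r =>
      (Isolated (insert (q, p) M) r ∨ IsRightEndpoint (insert (q, p) M) r) ∧
        VertVisible P (insert (q, p) M) r (q, p)).card := by
  have h : ¬ ∃ e ∈ insert (q, p) M, e.1 = p := by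
    rintro ⟨e, he, hep⟩
    rw [Finset.mem_insert] at he
    rcases he with rfl | he
    · simp only at hep; rw [hep] at hqp; exact lt_irrefl _ hqp
    · exact (hiso e he).1 hep
  have h' : ∃ e ∈ insert (q, p) M, e.2 = p := ⟨(q, p), by simp, rfl⟩
  have hc : h'.choose = (q, p) := by
    obtain ⟨he, hep⟩ := h'.choose_spec
    rw [Finset.mem_insert] at he
    rcases he with he | he
    · exact he
    · exact absurd hep (hiso _ he).2
  unfold rank
  rw [dif_neg h, dif_pos h', hc]

theorem rank_right (P : Finset Pt) (M : Finset (Pt × Pt)) (p q : Pt)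
    (hiso : Isolated M p) :
    rank P (insert (p, q) M) p = (P.filter fun r =>
      (Isolated (insert (p, q) M) r ∨ IsLeftEndpoint (insert (p, q) M) r) ∧
        VertVisible P (insert (p, q) M) r (p, q)).card := by
  have h' : ∃ e ∈ insert (p, q) M, e.1 = p := ⟨(p, q), by simp, rfl⟩
  have hc : h'.choose = (p, q) := by
    obtain ⟨he, hep⟩ := h'.choose_spec
    rw [Finset.mem_insert] at he
    rcases he with he | he
    · exact he
    · exact absurd hep (hiso _ he).1
  unfold rank
  rw [dif_pos h', hc]

theorem isolated_insert (M : Finset (Pt × Pt)) (e : Pt × Pt) (r : Pt) (h1 : e.1.1 < r.1)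
    (h2 : r.1 < e.2.1) (h : Isolated M r) : Isolated (insert e M) r := by
  intro f hf
  rw [Finset.mem_insert] at hf
  rcases hf with rfl | hf
  · exact ⟨fun h => by rw [h] at h1; exact lt_irrefl _ h1,
      fun h => by rw [h] at h2; exact lt_irrefl _ h2⟩
  · exact h f hf

theorem left_bound (P : Finset Pt) (hP : GenPos P)
    (M : Finset (Pt × Pt)) (hM : IsMatching P M)
    (p : Pt) (hp : p ∈ P) (hiso : Isolated M p) :
    ∑ q ∈ P.filter (fun q => q.1 < p.1 ∧ IsMatching P (insert (q, p) M)),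
      (5 - rank P (insert (q, p) M) p) ≤ 24 := by
  have hnm : ∀ q, (q, p) ∉ M := fun q h => (hiso _ h).2 rfl
  refine core P (fun r => r.1) (fun r => r.2) ?_ M (fun e => e.1) (fun e => e.2) yOn
    hM.left_mem hM.right_mem ?_ ?_ _ (Finset.filter_subset _ _) ?_ p (fun q => yOn (q, p))
    ?_ ?_ ?_ ?_ _ ?_
  · intro a ha b hb h
    by_contra hc
    exact hP.2 a ha b hb hc h
  · intro f hf g hg h
    by_contra hc
    exact (hM.no_shared f hf g hg hc).2.2.2 h
  · intro f hf
    exact yOn_right f (hM.x_lt f hf)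
  · intro q hq f hf
    rw [Finset.mem_filter] at hq
    have := hq.2.2.no_shared (q, p) (by simp) f (by simp [hf])
      (fun h => hnm q (h ▸ hf))
    exact ⟨this.1.symm, this.2.1.symm⟩
  · intro q hq
    exact yOn_left (q, p)
  · intro q hq
    rw [Finset.mem_filter] at hq
    exact yOn_right (q, p) hq.2.1
  · intro q hq
    rw [Finset.mem_filter] at hq
    exact hq.2.1
  · intro q hq f hf s s' h1 h2 h3 h4 h5 h6 h7 h8
    rw [Finset.mem_filter] at hq
    have hd := hq.2.2.no_cross (q, p) (by simp) f (by simp [hf]) (fun h => hnm q (h ▸ hf))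
    exact ⟨side_const (q, p) f hq.2.1 (hM.x_lt f hf) hd s s' h1 h2 h3 h4 h5 h6 h7 h8,
      side_const (q, p) f hq.2.1 (hM.x_lt f hf) hd s' s h3 h4 h1 h2 h7 h8 h5 h6⟩
  · intro q hq
    rw [Finset.mem_filter] at hq
    rw [rank_left P M p q hq.2.1 hiso]
    apply Finset.card_le_card
    intro r hr
    rw [Finset.mem_filter] at hr ⊢
    obtain ⟨hrP, h1, h2, h3, h4⟩ := hr
    refine ⟨hrP, ?_, ?_⟩
    · rcases h3 with h3 | ⟨f, hf, h3⟩
      · exact Or.inl (isolated_insert M (q, p) r h1 h2 h3)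
      · exact Or.inr ⟨f, by simp [hf], h3⟩
    · apply vis_of P hP M hM (q, p) hq.1 hp hq.2.1 r hrP h1 h2
      intro g hg ha hb hc hd
      refine h4 g hg ha (lt_of_le_of_ne hb fun h => ?_)
      exact hP.2 _ (hM.right_mem g hg) r hrP hd h.symm

theorem right_bound (P : Finset Pt) (hP : GenPos P)
    (M : Finset (Pt × Pt)) (hM : IsMatching P M)
    (p : Pt) (hp : p ∈ P) (hiso : Isolated M p) :
    ∑ q ∈ P.filter (fun q => p.1 < q.1 ∧ IsMatching P (insert (p, q) M)),
      (5 - rank P (insert (p, q) M) p) ≤ 24 := by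
  have hnm : ∀ q, (p, q) ∉ M := fun q h => (hiso _ h).1 rfl
  refine core P (fun r => -r.1) (fun r => r.2) ?_ M (fun e => e.2) (fun e => e.1)
    (fun e s => yOn e (-s))
    hM.right_mem hM.left_mem ?_ ?_ _ (Finset.filter_subset _ _) ?_ p
    (fun q s => yOn (p, q) (-s))
    ?_ ?_ ?_ ?_ _ ?_
  · intro a ha b hb h
    by_contra hc
    exact hP.2 a ha b hb hc (neg_injective h)
  · intro f hf g hg h
    by_contra hc
    exact (hM.no_shared f hf g hg hc).1 h
  · intro f hf
    simp only [neg_neg]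
    exact yOn_left f
  · intro q hq f hf
    rw [Finset.mem_filter] at hq
    have := hq.2.2.no_shared (p, q) (by simp) f (by simp [hf])
      (fun h => hnm q (h ▸ hf))
    exact ⟨this.2.2.2.symm, this.2.2.1.symm⟩
  · intro q hq
    rw [Finset.mem_filter] at hq
    simp only [neg_neg]
    exact yOn_right (p, q) hq.2.1
  · intro q hq
    simp only [neg_neg]
    exact yOn_left (p, q)
  · intro q hq
    rw [Finset.mem_filter] at hq
    exact neg_lt_neg hq.2.1
  · intro q hq f hf s s' h1 h2 h3 h4 h5 h6 h7 h8
    rw [Finset.mem_filter] at hq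
    have hd := hq.2.2.no_cross (p, q) (by simp) f (by simp [hf]) (fun h => hnm q (h ▸ hf))
    constructor
    · apply side_const (p, q) f hq.2.1 (hM.x_lt f hf) hd <;> (try simp only) <;> linarith
    · apply side_const (p, q) f hq.2.1 (hM.x_lt f hf) hd <;> (try simp only) <;> linarith
  · intro q hq
    rw [Finset.mem_filter] at hq
    rw [rank_right P M p q hiso]
    apply Finset.card_le_card
    intro r hr
    rw [Finset.mem_filter] at hr ⊢
    simp only [neg_neg, neg_lt_neg_iff, neg_le_neg_iff] at hr
    obtain ⟨hrP, h2, h1, h3, h4⟩ := hr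
    refine ⟨hrP, ?_, ?_⟩
    · rcases h3 with h3 | ⟨f, hf, h3⟩
      · exact Or.inl (isolated_insert M (p, q) r h1 h2 fun f hf => (h3 f hf).symm)
      · exact Or.inr ⟨f, by simp [hf], h3⟩
    · apply vis_of P hP M hM (p, q) hp hq.1 hq.2.1 r hrP h1 h2
      intro g hg ha hb hc hd
      refine h4 g hg hb (lt_of_le_of_ne ha fun h => ?_)
      exact hP.2 _ (hM.left_mem g hg) r hrP hc h

/-- For every crossing-free matching `M` of `P` and every
point `p` of `P` that is isolated in `M`,
`Σ_{i=0}^{5} (5−i)·h_i(p,M) ≤ 48`. -/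
theorem weighted_hcount_five_le (P : Finset Pt) (hP : GenPos P)
    (M : Finset (Pt × Pt)) (hM : IsMatching P M)
    (p : Pt) (hp : p ∈ P) (hiso : Isolated M p) :
    ∑ i ∈ Finset.range 6, (5 - i) * hcount P M p i ≤ 48 := by
  have hL := left_bound P hP M hM p hp hiso
  have hR := right_bound P hP M hM p hp hiso
  have h1 : ∑ i ∈ Finset.range 6, (5 - i) * hcount P M p i =
      ∑ q ∈ P.filter (fun q => IsMatching P (addEdge M q p)),
        (5 - rank P (addEdge M q p) p) := by
    have hc : ∀ i, hcount P M p i =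
        ∑ q ∈ P.filter (fun q => IsMatching P (addEdge M q p)),
          if rank P (addEdge M q p) p = i then 1 else 0 := by
      intro i
      rw [hcount, ← Finset.filter_filter, Finset.card_filter]
    simp only [hc, Finset.mul_sum]
    rw [Finset.sum_comm]
    apply Finset.sum_congr rfl
    intro q _
    simp only [mul_ite, mul_one, mul_zero]
    rw [Finset.sum_ite_eq]
    split_ifs with h
    · rfl
    · rw [Finset.mem_range] at h
      omega
  rw [h1, ← Finset.sum_filter_add_sum_filter_not _ (fun q : Pt => q.1 < p.1)]
  refine le_trans (add_le_add (le_trans (le_of_eq ?_) hL) (le_trans (le_of_eq ?_) hR)) (by norm_num)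
  · apply Finset.sum_congr
    · ext q
      simp only [Finset.mem_filter]
      constructor
      · rintro ⟨⟨a, b⟩, c⟩
        rw [addEdge, if_pos c] at b
        exact ⟨a, c, b⟩
      · rintro ⟨a, c, b⟩
        rw [addEdge, if_pos c]
        exact ⟨⟨a, b⟩, c⟩
    · intro q hq
      rw [Finset.mem_filter] at hq
      rw [addEdge, if_pos hq.2.1]
  · apply Finset.sum_congr
    · ext q
      simp only [Finset.mem_filter]
      constructor
      · rintro ⟨⟨a, b⟩, c⟩
        rw [addEdge, if_neg c] at b
        exact ⟨a, b.x_lt (p, q) (by simp), b⟩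
      · rintro ⟨a, c, b⟩
        rw [addEdge, if_neg c.not_gt]
        exact ⟨⟨a, b⟩, c.not_gt⟩
    · intro q hq
      rw [Finset.mem_filter] at hq
      rw [addEdge, if_neg hq.2.1.not_gt]
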